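/- arXiv:2308.00957 — 2 statements merged into one kernel-verified Lean document; each statement's English description precedes it below -/
import Mathlib

section
/- Fix a finite set 𝒴 with K := |𝒴| ≥ 1 elements, reals γ > 0 with Kγ < 1, and a positive integer n. Let q, q' : 𝒴 → ℝ satisfy γ ≤ q(y) ≤ 1 and γ ≤ q'(y) ≤ 1 for all y, and set Δ := 1 − Σ_y q(y), Δ' := 1 − Σ_y q'(y). Assume Δ < 0, Δ' < 0, |q(y) − q'(y)| ≤ 1/n for all y, and |Δ − Δ'| ≤ 1/n. Define q̃(y) := γ + (q(y) − γ)·(1 − Kγ)/(1 − Δ − Kγ) and q̃'(y) := γ + (q'(y) − γ)·(1 − Kγ)/(1 − Δ' − Kγ). Then for every y ∈ 𝒴, |q̃(y) − q̃'(y)| ≤ 2/n. -/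
open Finset

/-- Rescaling a component `a` of total mass `S` by `s / S` with `s ≤ S` is stable in `(a, S)`. -/
lemma abs_mul_div_sub_mul_div_le {a b s S T : ℝ} (hs : 0 < s) (hsS : s ≤ S) (hT : 0 < T)
    (hb : 0 ≤ b) (hbT : b ≤ T) :
    |a * s / S - b * s / T| ≤ |a - b| + |T - S| := by
  have hS : 0 < S := hs.trans_le hsS
  have hr₀ : 0 ≤ s / S := by positivity
  have hr₁ : s / S ≤ 1 := (div_le_one hS).2 hsS
  have ht₀ : 0 ≤ b / T := by positivity
  have ht₁ : b / T ≤ 1 := (div_le_one hT).2 hbT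
  have key : a * s / S - b * s / T = s / S * (a - b) + s / S * (b / T) * (T - S) := by
    field_simp
    ring
  rw [key]
  refine (abs_add_le _ _).trans (add_le_add ?_ ?_)
  · rw [abs_mul, abs_of_nonneg hr₀]
    exact mul_le_of_le_one_left (abs_nonneg _) hr₁
  · rw [abs_mul, abs_of_nonneg (mul_nonneg hr₀ ht₀)]
    exact mul_le_of_le_one_left (abs_nonneg _) (mul_le_one₀ hr₁ ht₀ ht₁)

/-- Case Δ < 0, Δ' < 0 of the stability proof for the renormalization step of the
Cluster-DP mechanism. -/
theorem cluster_dp_renormalization_stability_neg_case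
    {Y : Type*} [Fintype Y]
    (hK : 1 ≤ Fintype.card Y)
    (γ : ℝ) (hγpos : 0 < γ) (hKγ : (Fintype.card Y : ℝ) * γ < 1)
    (n : ℕ) (hn : 0 < n)
    (q q' : Y → ℝ)
    (hq : ∀ y, γ ≤ q y ∧ q y ≤ 1) (hq' : ∀ y, γ ≤ q' y ∧ q' y ≤ 1)
    (Δ Δ' : ℝ) (hΔ : Δ = 1 - ∑ y, q y) (hΔ' : Δ' = 1 - ∑ y, q' y)
    (hΔneg : Δ < 0) (hΔ'neg : Δ' < 0)
    (hclose : ∀ y, |q y - q' y| ≤ 1 / (n : ℝ))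
    (hΔclose : |Δ - Δ'| ≤ 1 / (n : ℝ))
    (qt qt' : Y → ℝ)
    (hqt : ∀ y, qt y = γ + (q y - γ) * (1 - (Fintype.card Y : ℝ) * γ)
        / (1 - Δ - (Fintype.card Y : ℝ) * γ))
    (hqt' : ∀ y, qt' y = γ + (q' y - γ) * (1 - (Fintype.card Y : ℝ) * γ)
        / (1 - Δ' - (Fintype.card Y : ℝ) * γ)) :
    ∀ y, |qt y - qt' y| ≤ 2 / (n : ℝ) := by
  intro y
  have hmass : q' y - γ ≤ 1 - Δ' - (Fintype.card Y : ℝ) * γ := by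
    have hle : q' y - γ ≤ ∑ z, (q' z - γ) :=
      single_le_sum (f := fun z => q' z - γ) (fun z _ => sub_nonneg.2 (hq' z).1) (mem_univ y)
    rw [sum_sub_distrib, sum_const, card_univ, nsmul_eq_mul] at hle
    linarith
  have hstab := abs_mul_div_sub_mul_div_le (a := q y - γ) (b := q' y - γ)
    (s := 1 - (Fintype.card Y : ℝ) * γ) (S := 1 - Δ - (Fintype.card Y : ℝ) * γ)
    (T := 1 - Δ' - (Fintype.card Y : ℝ) * γ) (by linarith) (by linarith) (by linarith)
    (sub_nonneg.2 (hq' y).1) hmass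
  rw [sub_sub_sub_cancel_right, sub_sub_sub_cancel_right, sub_sub_sub_cancel_left] at hstab
  rw [hqt, hqt', add_sub_add_left_eq_sub]
  calc _ ≤ |q y - q' y| + |Δ - Δ'| := hstab
    _ ≤ 1 / (n : ℝ) + 1 / (n : ℝ) := add_le_add (hclose y) hΔclose
    _ = 2 / (n : ℝ) := by ring
end

section
/- Let K be a positive integer, λ ∈ [0,1) a real number, and q̃ ∈ ℝ^K a vector with 𝟙ᵀq̃ = 1. Set Q := (1−λ)·I + λ·q̃·𝟙ᵀ. Then: (i) Q·q̃ = q̃; and (ii) Q⁻¹·diag(Q·q̃)·Q⁻ᵀ = (1/(1−λ)²)·diag(q̃) + ((λ² − 2λ)/(1−λ)²)·q̃·q̃ᵀ, where diag(v) denotes the diagonal matrix with the entries of v on its diagonal and Q⁻ᵀ := (Q⁻¹)ᵀ. -/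
open Matrix

section ResponseRandomization

variable {n : Type*} [Fintype n] [DecidableEq n]

/-- Sherman–Morrison inverse of `(1 - c) • 1 + c • v 𝟙ᵀ` when the entries of `v` sum to one. -/
theorem inv_smul_one_add_smul_vecMulVec_one {c : ℝ} (hc : 1 - c ≠ 0) {v : n → ℝ}
    (hv : ∑ i, v i = 1) :
    ((1 - c) • (1 : Matrix n n ℝ) + c • vecMulVec v (fun _ => 1))⁻¹
      = (1 / (1 - c)) • (1 : Matrix n n ℝ) - (c / (1 - c)) • vecMulVec v (fun _ => 1) := by
  have hidem : vecMulVec v (fun _ : n => 1) * vecMulVec v (fun _ : n => 1)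
      = vecMulVec v (fun _ : n => (1 : ℝ)) := by
    ext i j
    simp [Matrix.mul_apply, vecMulVec_apply, ← Finset.mul_sum, hv]
  apply Matrix.inv_eq_right_inv
  simp only [add_mul, mul_sub, smul_mul_assoc, mul_smul_comm, one_mul, mul_one, hidem]
  match_scalars <;> field_simp <;> ring

theorem smul_one_add_smul_vecMulVec_one_mulVec (c : ℝ) {v : n → ℝ} (hv : ∑ i, v i = 1) :
    ((1 - c) • (1 : Matrix n n ℝ) + c • vecMulVec v (fun _ => 1)) *ᵥ v = v := by
  have hfix : vecMulVec v (fun _ => (1 : ℝ)) *ᵥ v = v := by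
    ext i
    simp [mulVec, dotProduct, vecMulVec_apply, ← Finset.mul_sum, hv]
  rw [add_mulVec, smul_mulVec, smul_mulVec, one_mulVec, hfix]
  module

/-- Congruence of `diagonal v` by `a • 1 - b • v 𝟙ᵀ` when the entries of `v` sum to one. -/
theorem smul_one_sub_smul_vecMulVec_one_congr_diagonal (a b : ℝ) {v : n → ℝ}
    (hv : ∑ i, v i = 1) :
    (a • (1 : Matrix n n ℝ) - b • vecMulVec v (fun _ => 1)) * diagonal v
        * (a • (1 : Matrix n n ℝ) - b • vecMulVec v (fun _ => 1))ᵀ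
      = a ^ 2 • diagonal v + (b ^ 2 - 2 * a * b) • vecMulVec v v := by
  have hleft : vecMulVec v (fun _ => (1 : ℝ)) * diagonal v = vecMulVec v v := by
    ext i j
    simp [Matrix.mul_diagonal, vecMulVec_apply]
  have hright : diagonal v * vecMulVec (fun _ => (1 : ℝ)) v = vecMulVec v v := by
    ext i j
    simp [Matrix.diagonal_mul, vecMulVec_apply]
  have hboth : vecMulVec v v * vecMulVec (fun _ => (1 : ℝ)) v = vecMulVec v v := by
    ext i j
    simp [Matrix.mul_apply, vecMulVec_apply, ← Finset.mul_sum, ← Finset.sum_mul, hv]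
  simp only [transpose_sub, transpose_smul, transpose_one, transpose_vecMulVec, sub_mul, mul_sub,
    smul_mul_assoc, mul_smul_comm, one_mul, mul_one, hleft, hright, hboth]
  module

end ResponseRandomization

/-- Core identities of the 'Term I' computation in the variance bound of the debiased
Cluster-DP estimator: `Q q̃ = q̃` and
`Q⁻¹ diag(Q q̃) Q⁻ᵀ = (1/(1−λ)²) diag(q̃) + ((λ²−2λ)/(1−λ)²) q̃ q̃ᵀ`. -/
theorem cluster_dp_termI_identities
    (K : ℕ) (hK : 0 < K) (lam : ℝ) (hlam0 : 0 ≤ lam) (hlam1 : lam < 1)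
    (qt : Fin K → ℝ) (hsum : ∑ i, qt i = 1)
    (Q : Matrix (Fin K) (Fin K) ℝ)
    (hQ : Q = (1 - lam) • (1 : Matrix (Fin K) (Fin K) ℝ)
        + lam • Matrix.vecMulVec qt (fun _ => 1)) :
    Q *ᵥ qt = qt ∧
      Q⁻¹ * Matrix.diagonal (Q *ᵥ qt) * Q⁻¹ᵀ
        = (1 / (1 - lam) ^ 2) • Matrix.diagonal qt
          + ((lam ^ 2 - 2 * lam) / (1 - lam) ^ 2) • Matrix.vecMulVec qt qt := by
  have hc : 1 - lam ≠ 0 := (sub_pos.mpr hlam1).ne'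
  subst hQ
  have hfix := smul_one_add_smul_vecMulVec_one_mulVec lam hsum
  refine ⟨hfix, ?_⟩
  rw [hfix, inv_smul_one_add_smul_vecMulVec_one hc hsum,
    smul_one_sub_smul_vecMulVec_one_congr_diagonal _ _ hsum]
  congr 2 <;> field_simp
end
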